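/- Under the stated assumptions on γ, the limiting moment generating function Λ satisfies: Λ(λ) < ∞ for every λ ∈ ℝ; Λ is differentiable and strictly convex on ℝ; Λ(0) = 0 and Λ′(0) = 0; and consequently the convex dual I(x) = sup_{λ∈ℝ}(λx − Λ(λ)) satisfies I(0) = 0 and I(x) > 0 for every x ≠ 0 (the rate function has a unique zero at zero). -/

import Mathlib

open MeasureTheory Real

/-- The centered Gaussian density with variance `s`. -/
noncomputable def gphi (s x : ℝ) : ℝ :=
  (Real.sqrt (2 * Real.pi * s))⁻¹ * Real.exp (-(x ^ 2) / (2 * s))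

/-- The centered Gaussian distribution function with variance `s`. -/
noncomputable def gPhi (s x : ℝ) : ℝ := ∫ y in Set.Iic x, gphi s y


/-- The cumulant generating function of the Bernoulli distribution with parameter `p`. -/
noncomputable def bernoulliCgf (p lam : ℝ) : ℝ := Real.log (1 + (Real.exp lam - 1) * p)

lemma bernoulliMgf_pos {p : ℝ} (hp₀ : 0 ≤ p) (hp₁ : p < 1) (lam : ℝ) :
    0 < 1 + (Real.exp lam - 1) * p := by
  nlinarith [mul_nonneg (Real.exp_pos lam).le hp₀]

lemma hasDerivAt_bernoulliCgf {p : ℝ} (hp₀ : 0 ≤ p) (hp₁ : p < 1) (lam : ℝ) :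
    HasDerivAt (bernoulliCgf p) (Real.exp lam * p / (1 + (Real.exp lam - 1) * p)) lam :=
  ((((Real.hasDerivAt_exp lam).sub_const 1).mul_const p).const_add 1).log
    (bernoulliMgf_pos hp₀ hp₁ lam).ne'

lemma strictConvexOn_bernoulliCgf {p : ℝ} (hp₀ : 0 < p) (hp₁ : p < 1) :
    StrictConvexOn ℝ Set.univ (bernoulliCgf p) := by
  refine StrictMono.strictConvexOn_univ_of_deriv
    (continuous_iff_continuousAt.2 fun x => (hasDerivAt_bernoulliCgf hp₀.le hp₁ x).continuousAt)
    fun a b hab => ?_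
  rw [(hasDerivAt_bernoulliCgf hp₀.le hp₁ a).deriv, (hasDerivAt_bernoulliCgf hp₀.le hp₁ b).deriv,
    div_lt_div_iff₀ (bernoulliMgf_pos hp₀.le hp₁ a) (bernoulliMgf_pos hp₀.le hp₁ b)]
  nlinarith [mul_pos (mul_pos hp₀ (sub_pos.2 hp₁)) (sub_pos.2 (Real.exp_lt_exp.2 hab))]

@[simp] lemma bernoulliCgf_zero_right (p : ℝ) : bernoulliCgf p 0 = 0 := by simp [bernoulliCgf]

lemma bernoulliCgf_nonneg {p lam : ℝ} (hp₀ : 0 ≤ p) (hlam : 0 ≤ lam) : 0 ≤ bernoulliCgf p lam :=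
  Real.log_nonneg (by nlinarith [Real.add_one_le_exp lam])

lemma add_log_le_bernoulliCgf {p lam : ℝ} (hp₀ : 0 < p) (hp₁ : p < 1) :
    lam + Real.log p ≤ bernoulliCgf p lam := by
  rw [← Real.log_exp lam, ← Real.log_mul (Real.exp_pos _).ne' hp₀.ne', Real.log_exp]
  exact Real.log_le_log (by positivity) (by linarith)

lemma exists_deriv_comp_bernoulliCgf_le {γ : ℝ → ℝ} (hγ : ContDiff ℝ 1 γ) (R : ℝ) :
    ∃ C, ∀ lam ∈ Set.Icc (-R) R, ∀ p ∈ Set.Icc (0 : ℝ) (1 / 2),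
      |deriv γ (bernoulliCgf p lam) * (Real.exp lam * p / (1 + (Real.exp lam - 1) * p))|
        ≤ C * p := by
  have hpos : ∀ x ∈ Set.Icc (-R) R ×ˢ Set.Icc (0 : ℝ) (1 / 2),
      1 + (Real.exp x.1 - 1) * x.2 ≠ 0 := fun x hx =>
    (bernoulliMgf_pos hx.2.1 (hx.2.2.trans_lt (by norm_num)) x.1).ne'
  have hcont : ContinuousOn (fun x : ℝ × ℝ => deriv γ (bernoulliCgf x.2 x.1) *
      (Real.exp x.1 / (1 + (Real.exp x.1 - 1) * x.2)))
      (Set.Icc (-R) R ×ˢ Set.Icc (0 : ℝ) (1 / 2)) := by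
    have hden : ContinuousOn (fun x : ℝ × ℝ => 1 + (Real.exp x.1 - 1) * x.2)
      (Set.Icc (-R) R ×ˢ Set.Icc (0 : ℝ) (1 / 2)) := by fun_prop
    exact ((hγ.continuous_deriv le_rfl).comp_continuousOn (hden.log hpos)).mul
      (ContinuousOn.div (by fun_prop) hden hpos)
  obtain ⟨C, hC⟩ := (isCompact_Icc.prod isCompact_Icc).exists_bound_of_continuousOn hcont
  refine ⟨C, fun lam hlam p hp => ?_⟩
  rw [mul_div_right_comm, ← mul_assoc, abs_mul, abs_of_nonneg hp.1]
  exact mul_le_mul_of_nonneg_right (hC (lam, p) ⟨hlam, hp⟩) hp.1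

lemma StrictConvexOn.integral {α : Type*} [MeasurableSpace α] {μ : Measure α} [NeZero μ]
    {F : ℝ → α → ℝ} (hint : ∀ x, Integrable (F x) μ)
    (hF : ∀ᵐ a ∂μ, StrictConvexOn ℝ Set.univ (F · a)) :
    StrictConvexOn ℝ Set.univ (fun x => ∫ a, F x a ∂μ) := by
  refine ⟨convex_univ, fun x _ y _ hxy a b ha hb hab => ?_⟩
  have hi : Integrable (fun ω => a * F x ω + b * F y ω) μ :=
    ((hint x).const_mul a).add ((hint y).const_mul b)
  have hlt : ∀ᵐ ω ∂μ, 0 < a * F x ω + b * F y ω - F (a • x + b • y) ω := by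
    filter_upwards [hF] with ω hω
    exact sub_pos.2 (hω.2 trivial trivial hxy ha hb hab)
  have hpos : 0 < ∫ ω, (a * F x ω + b * F y ω - F (a • x + b • y) ω) ∂μ := by
    rw [integral_pos_iff_support_of_nonneg_ae (hlt.mono fun _ h => h.le) (hi.sub (hint _))]
    have : Function.support (fun ω => a * F x ω + b * F y ω - F (a • x + b • y) ω)
        =ᵐ[μ] Set.univ := by
      filter_upwards [hlt] with ω hω
      exact eq_true hω.ne'
    rw [measure_congr this]
    exact NeZero.pos _
  rw [integral_sub hi (hint _), integral_add ((hint x).const_mul a) ((hint y).const_mul b),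
    integral_const_mul, integral_const_mul] at hpos
  exact sub_pos.1 hpos

lemma hasDerivAt_comp_bernoulliCgf {γ : ℝ → ℝ} (hγ : ContDiff ℝ 1 γ) {p : ℝ} (hp₀ : 0 ≤ p)
    (hp₁ : p < 1) (lam : ℝ) :
    HasDerivAt (fun l => γ (bernoulliCgf p l))
      (deriv γ (bernoulliCgf p lam) * (Real.exp lam * p / (1 + (Real.exp lam - 1) * p))) lam :=
  ((hγ.differentiable one_ne_zero _).hasDerivAt).comp lam (hasDerivAt_bernoulliCgf hp₀ hp₁ lam)

section Integral

variable {α : Type*} [MeasurableSpace α] {μ : Measure α} {γ : ℝ → ℝ} {p : α → ℝ}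

lemma aestronglyMeasurable_comp_bernoulliCgf (hγ : Continuous γ) (hp : AEMeasurable p μ)
    (lam : ℝ) : AEStronglyMeasurable (fun a => γ (bernoulliCgf (p a) lam)) μ := by
  refine (hγ.measurable.comp_aemeasurable ?_).aestronglyMeasurable
  unfold bernoulliCgf
  fun_prop

lemma integrable_comp_bernoulliCgf (hγ : ContDiff ℝ 1 γ) (hγ₀ : γ 0 = 0) (hp : Integrable p μ)
    (hp' : ∀ᵐ a ∂μ, p a ∈ Set.Icc (0 : ℝ) (1 / 2)) (lam : ℝ) :
    Integrable (fun a => γ (bernoulliCgf (p a) lam)) μ := by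
  obtain ⟨C, hC⟩ := exists_deriv_comp_bernoulliCgf_le hγ |lam|
  refine ((hp.const_mul C).mul_const |lam|).mono'
    (aestronglyMeasurable_comp_bernoulliCgf hγ.continuous hp.aemeasurable lam) ?_
  filter_upwards [hp'] with a ha
  have := (convex_Icc (-|lam|) |lam|).norm_image_sub_le_of_norm_hasDerivWithin_le
    (fun l _ => (hasDerivAt_comp_bernoulliCgf hγ ha.1
      (ha.2.trans_lt (by norm_num)) l).hasDerivWithinAt)
    (fun l hl => hC l hl (p a) ha) (x := 0) (y := lam) (by simp) (abs_le.1 le_rfl)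
  simpa [hγ₀] using this

lemma differentiable_integral_comp_bernoulliCgf (hγ : ContDiff ℝ 1 γ) (hγ₀ : γ 0 = 0)
    (hp : Integrable p μ) (hp' : ∀ᵐ a ∂μ, p a ∈ Set.Icc (0 : ℝ) (1 / 2)) :
    Differentiable ℝ (fun lam => ∫ a, γ (bernoulliCgf (p a) lam) ∂μ) := by
  intro lam
  obtain ⟨C, hC⟩ := exists_deriv_comp_bernoulliCgf_le hγ (|lam| + 1)
  have hmem : Set.Icc (-(|lam| + 1)) (|lam| + 1) ∈ nhds lam :=
    Icc_mem_nhds (by linarith [neg_abs_le lam]) (by linarith [le_abs_self lam])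
  refine (hasDerivAt_integral_of_dominated_loc_of_deriv_le (bound := fun a => C * p a)
    (F' := fun l a => deriv γ (bernoulliCgf (p a) l) *
      (Real.exp l * p a / (1 + (Real.exp l - 1) * p a))) hmem
    (.of_forall fun l => aestronglyMeasurable_comp_bernoulliCgf hγ.continuous hp.aemeasurable l)
    (integrable_comp_bernoulliCgf hγ hγ₀ hp hp' lam) ?_ ?_ (hp.const_mul C) ?_).2.differentiableAt
  · have hpm := hp.aemeasurable
    refine (aestronglyMeasurable_comp_bernoulliCgf (hγ.continuous_deriv le_rfl) hpm lam).mul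
      (AEMeasurable.aestronglyMeasurable ?_)
    fun_prop
  · filter_upwards [hp'] with a ha l hl using hC l hl (p a) ha
  · filter_upwards [hp'] with a ha l _ using
      hasDerivAt_comp_bernoulliCgf hγ ha.1 (ha.2.trans_lt (by norm_num)) l

lemma strictConvexOn_integral_comp_bernoulliCgf [NeZero μ] (hγ : ContDiff ℝ 1 γ) (hγ₀ : γ 0 = 0)
    (hmono : StrictMono γ) (hconv : ConvexOn ℝ Set.univ γ)
    (hp : Integrable p μ) (hp' : ∀ᵐ a ∂μ, p a ∈ Set.Ioc (0 : ℝ) (1 / 2)) :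
    StrictConvexOn ℝ Set.univ (fun lam => ∫ a, γ (bernoulliCgf (p a) lam) ∂μ) := by
  refine StrictConvexOn.integral (integrable_comp_bernoulliCgf hγ hγ₀ hp
    (hp'.mono fun _ h => Set.Ioc_subset_Icc_self h)) ?_
  filter_upwards [hp'] with a ha
  refine ⟨convex_univ, fun x _ y _ hxy s t hs ht hst => ?_⟩
  exact (hmono ((strictConvexOn_bernoulliCgf ha.1 (ha.2.trans_lt (by norm_num))).2
    trivial trivial hxy hs ht hst)).trans_le (hconv.2 trivial trivial hs.le ht.le hst)

end Integral

lemma ConvexOn.exists_pos_mul_sub_one_le {γ : ℝ → ℝ} (hconv : ConvexOn ℝ Set.univ γ)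
    (hmono : StrictMono γ) (hγ₀ : γ 0 = 0) :
    ∃ c, 0 < c ∧ ∀ z, 0 ≤ z → c * (z - 1) ≤ γ z := by
  have h1 : 0 < γ 1 := hγ₀ ▸ hmono one_pos
  refine ⟨γ 1, h1, fun z hz => ?_⟩
  have hz' : 0 ≤ γ z := hγ₀ ▸ hmono.monotone hz
  rcases le_total z 1 with h | h
  · nlinarith
  · have := hconv.2 (Set.mem_univ 0) (Set.mem_univ z) (sub_nonneg.2 (inv_le_one_of_one_le₀ h))
      (inv_nonneg.2 hz) (sub_add_cancel _ _)
    have hz0 : 0 < z := by linarith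
    simp only [smul_eq_mul, mul_zero, zero_add, inv_mul_cancel₀ hz0.ne', hγ₀] at this
    rw [inv_mul_eq_div, le_div_iff₀ hz0] at this
    linarith

lemma exists_mul_sub_le_setIntegral_comp_bernoulliCgf {γ p : ℝ → ℝ} (hγ : ContDiff ℝ 1 γ)
    (hγ₀ : γ 0 = 0) (hmono : StrictMono γ) (hconv : ConvexOn ℝ Set.univ γ)
    (hp : IntegrableOn p (Set.Ioi 0)) (hp' : ∀ y, 0 < y → p y ∈ Set.Ioc (0 : ℝ) (1 / 2))
    (hanti : AntitoneOn p (Set.Ioi 0)) (A : ℝ) :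
    ∃ C, ∀ lam, 0 ≤ lam →
      A * lam - C ≤ ∫ y in Set.Ioi 0, γ (bernoulliCgf (p y) lam) := by
  obtain ⟨c, hc, hlin⟩ := hconv.exists_pos_mul_sub_one_le hmono hγ₀
  set M : ℝ := |A| / c + 1 with hM
  have hM0 : 0 < M := by positivity
  refine ⟨M * (c * (1 - Real.log (p M))), fun lam hlam => ?_⟩
  have hint := integrable_comp_bernoulliCgf hγ hγ₀ hp ((ae_restrict_iff' measurableSet_Ioi).2
    (.of_forall fun y hy => Set.Ioc_subset_Icc_self (hp' y hy))) lam
  have hnonneg : ∀ y ∈ Set.Ioi (0 : ℝ), 0 ≤ γ (bernoulliCgf (p y) lam) := fun y hy =>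
    hγ₀ ▸ hmono.monotone (bernoulliCgf_nonneg (hp' y hy).1.le hlam)
  have hsub : Set.Ioc 0 M ⊆ Set.Ioi (0 : ℝ) := fun y hy => hy.1
  calc A * lam - M * (c * (1 - Real.log (p M)))
      ≤ M * (c * (lam + Real.log (p M) - 1)) := by
        have : A ≤ M * c := by
          rw [hM, add_mul, div_mul_cancel₀ _ hc.ne']
          linarith [le_abs_self A]
        nlinarith
    _ = ∫ _ in Set.Ioc 0 M, c * (lam + Real.log (p M) - 1) := by
        simp [hM0.le]
    _ ≤ ∫ y in Set.Ioc 0 M, γ (bernoulliCgf (p y) lam) := by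
        refine setIntegral_mono_on (integrable_const _) (IntegrableOn.mono_set hint hsub)
          measurableSet_Ioc fun y hy => ?_
        obtain ⟨hy₀, hy₁⟩ := hp' y hy.1
        refine le_trans ?_ (hlin _ (bernoulliCgf_nonneg hy₀.le hlam))
        have h1 := add_log_le_bernoulliCgf (lam := lam) hy₀ (hy₁.trans_lt (by norm_num))
        have h2 := Real.log_le_log (hp' M hM0).1 (hanti hy.1 hM0 hy.2)
        gcongr
        linarith
    _ ≤ ∫ y in Set.Ioi 0, γ (bernoulliCgf (p y) lam) :=
        setIntegral_mono_set hint ((ae_restrict_iff' measurableSet_Ioi).2 (.of_forall hnonneg))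
          hsub.eventuallyLE

section Cgf

open ProbabilityTheory

variable {Ω : Type*} [MeasurableSpace Ω] {μ : Measure Ω} {X : Ω → ℝ}

lemma ProbabilityTheory.contDiff_cgf (hint : ∀ θ, Integrable (fun ω => Real.exp (θ * X ω)) μ)
    {n : WithTop ℕ∞} : ContDiff ℝ n (cgf X μ) := by
  have h : integrableExpSet X μ = Set.univ := Set.eq_univ_of_forall hint
  exact contDiff_iff_contDiffAt.2 fun θ => (analyticAt_cgf (by simp [h])).contDiffAt

lemma ProbabilityTheory.convexOn_cgf (hint : ∀ θ, Integrable (fun ω => Real.exp (θ * X ω)) μ) :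
    ConvexOn ℝ Set.univ (cgf X μ) := by
  have h : integrableExpSet X μ = Set.univ := Set.eq_univ_of_forall hint
  have hC : ContDiff ℝ 2 (cgf X μ) := contDiff_cgf hint
  refine convexOn_univ_of_deriv2_nonneg (hC.differentiable two_ne_zero)
    hC.differentiable_deriv_two fun θ => ?_
  rw [← iteratedDeriv_eq_iterate, iteratedDeriv_two_cgf_eq_integral (by simp [h])]
  exact div_nonneg (integral_nonneg fun ω => by positivity) mgf_nonneg

lemma ProbabilityTheory.strictMono_cgf [NeZero μ] (hnonneg : ∀ ω, 0 ≤ X ω)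
    (hpos : 0 < μ {ω | 0 < X ω}) (hint : ∀ θ, Integrable (fun ω => Real.exp (θ * X ω)) μ) :
    StrictMono (cgf X μ) := by
  intro a b hab
  refine Real.log_lt_log (mgf_pos' (NeZero.ne μ) (hint a)) (sub_pos.1 ?_)
  rw [mgf, mgf, ← integral_sub (hint b) (hint a), integral_pos_iff_support_of_nonneg
    (fun ω => sub_nonneg.2 (Real.exp_le_exp.2 (mul_le_mul_of_nonneg_right hab.le (hnonneg ω))))
    ((hint b).sub (hint a))]
  refine hpos.trans_le (measure_mono fun ω hω => ?_)
  exact (sub_pos.2 (Real.exp_lt_exp.2 (mul_lt_mul_of_pos_right hab hω))).ne'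

end Cgf

section Gaussian

open ProbabilityTheory

variable {s : ℝ}

lemma gPhi_eq_gaussianReal_real (hs : 0 < s) (x : ℝ) :
    gPhi s x = (gaussianReal 0 s.toNNReal).real (Set.Iic x) := by
  have hs' : s.toNNReal ≠ 0 := (Real.toNNReal_pos.2 hs).ne'
  rw [Measure.real, gaussianReal_apply_eq_integral 0 hs',
    ENNReal.toReal_ofReal (integral_nonneg fun y => gaussianPDFReal_nonneg _ _ _)]
  simp [gPhi, gphi, gaussianPDFReal, hs.le]

lemma monotone_gPhi (hs : 0 < s) : Monotone (gPhi s) := fun x y hxy => by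
  rw [gPhi_eq_gaussianReal_real hs, gPhi_eq_gaussianReal_real hs]
  exact measureReal_mono (Set.Iic_subset_Iic.2 hxy)

lemma gPhi_pos (hs : 0 < s) (x : ℝ) : 0 < gPhi s x := by
  have hs' : s.toNNReal ≠ 0 := (Real.toNNReal_pos.2 hs).ne'
  rw [gPhi_eq_gaussianReal_real hs, measureReal_def, ENNReal.toReal_pos_iff]
  refine ⟨pos_iff_ne_zero.2 fun h => ?_, measure_lt_top _ _⟩
  simpa using gaussianReal_absolutelyContinuous' 0 hs' h

lemma gPhi_neg (hs : 0 < s) (x : ℝ) : gPhi s (-x) = 1 - gPhi s x := by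
  have hs' : s.toNNReal ≠ 0 := (Real.toNNReal_pos.2 hs).ne'
  have := nullSingletonClass_gaussianReal (μ := 0) hs'
  rw [gPhi_eq_gaussianReal_real hs, gPhi_eq_gaussianReal_real hs,
    ← probReal_compl_eq_one_sub measurableSet_Iic, Set.compl_Iic,
    measureReal_congr (Ioi_ae_eq_Ici (a := x))]
  have hmap : (gaussianReal 0 s.toNNReal).map (fun x => -x) = gaussianReal 0 s.toNNReal := by
    rw [gaussianReal_map_neg, neg_zero]
  conv_lhs => rw [← hmap, map_measureReal_apply measurable_neg measurableSet_Iic]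
  simp

lemma gPhi_neg_mem_Ioc (hs : 0 < s) {y : ℝ} (hy : 0 < y) :
    gPhi s (-y) ∈ Set.Ioc (0 : ℝ) (1 / 2) := by
  have h := monotone_gPhi hs (show -y ≤ y by linarith)
  exact ⟨gPhi_pos hs _, by linarith [gPhi_neg hs y]⟩

lemma integrableOn_gPhi_neg (hs : 0 < s) : IntegrableOn (fun y => gPhi s (-y)) (Set.Ioi 0) := by
  have hexp : IntegrableOn (fun y : ℝ => Real.exp (-y) * mgf (fun x => -x)
      (gaussianReal 0 s.toNNReal) 1) (Set.Ioi 0) := (integrableOn_exp_neg_Ioi 0).mul_const _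
  refine hexp.mono' ((monotone_gPhi hs).measurable.comp measurable_neg).aestronglyMeasurable
    (.of_forall fun y => ?_)
  rw [Real.norm_of_nonneg (gPhi_pos hs _).le, gPhi_eq_gaussianReal_real hs]
  have := measure_ge_le_exp_mul_mgf (μ := gaussianReal 0 s.toNNReal) (X := fun x => -x) y
    zero_le_one (by simpa using integrable_exp_mul_gaussianReal (-1))
  simpa [Set.Iic, le_neg] using this

end Gaussian

section ConvexDual

variable {f : ℝ → ℝ}

lemma iSup_neg_eq_zero_of_convexOn_of_even (hconv : ConvexOn ℝ Set.univ f) (h₀ : f 0 = 0)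
    (heven : ∀ x, f (-x) = f x) : ⨆ l, -f l = 0 := by
  have hnonneg : ∀ l, 0 ≤ f l := fun l => by
    have := hconv.2 (Set.mem_univ l) (Set.mem_univ (-l)) (one_half_pos (α := ℝ)).le
      one_half_pos.le (add_halves 1)
    simp only [smul_eq_mul, mul_neg, add_neg_cancel, h₀, heven] at this
    linarith
  refine le_antisymm (Real.iSup_nonpos fun l => neg_nonpos.2 (hnonneg l)) ?_
  exact le_ciSup_of_le ⟨0, Set.forall_mem_range.2 fun l => neg_nonpos.2 (hnonneg l)⟩ 0
    (by simp [h₀])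

lemma iSup_mul_sub_pos (hf : HasDerivAt f 0 0) (h₀ : f 0 = 0) {x : ℝ} (hx : x ≠ 0)
    (hbdd : BddAbove (Set.range fun l => l * x - f l)) : 0 < ⨆ l, (l * x - f l) := by
  by_contra! h
  have hle : ∀ l, l * x - f l ≤ 0 := fun l => (le_ciSup hbdd l).trans h
  have hmax : IsLocalMax (fun l => l * x - f l) 0 := .of_forall fun l => by simpa [h₀] using hle l
  have hd : HasDerivAt (fun l => l * x - f l) (1 * x - 0) 0 := ((hasDerivAt_id _).mul_const x).sub hf
  exact hx (by simpa using hmax.hasDerivAt_eq_zero hd)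

lemma bddAbove_range_mul_sub (heven : ∀ x, f (-x) = f x)
    (hgrowth : ∀ A, ∃ C, ∀ l, 0 ≤ l → A * l - C ≤ f l) (x : ℝ) :
    BddAbove (Set.range fun l => l * x - f l) := by
  obtain ⟨C, hC⟩ := hgrowth |x|
  refine ⟨C, Set.forall_mem_range.2 fun l => ?_⟩
  have h1 := hC |l| (abs_nonneg l)
  have h2 : f |l| = f l := by rcases abs_choice l with h | h <;> simp [h, heven]
  have h3 : l * x ≤ |x| * |l| := (le_abs_self _).trans_eq (by rw [abs_mul, mul_comm])
  linarith

end ConvexDual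

/-- the limiting moment generating function `Λ` is finite everywhere,
differentiable and strictly convex, with `Λ(0) = 0` and `Λ′(0) = 0`; consequently its convex
dual `I` has a unique zero at `0`. -/
theorem Lambda_properties (t κ₂ : ℝ) (ht : 0 < t) (hκ : 0 < κ₂)
    (Ω : Type) [MeasureSpace Ω] [IsProbabilityMeasure (volume : Measure Ω)]
    (η : Ω → ℝ) (hmeas : Measurable η) (hnonneg : ∀ ω, 0 ≤ η ω)
    (hpos : 0 < volume {ω | 0 < η ω})
    (hint : ∀ θ : ℝ, Integrable (fun ω => Real.exp (θ * η ω)) volume)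
    (γ : ℝ → ℝ) (hγ : ∀ θ, γ θ = Real.log (∫ ω, Real.exp (θ * η ω)))
    (Z : ℝ → ℝ → ℝ)
    (hZ : ∀ lam y, Z lam y =
      if 0 < y then Real.log (gPhi (κ₂ * t) y + Real.exp lam * (1 - gPhi (κ₂ * t) y))
      else Real.log (Real.exp (-lam) * gPhi (κ₂ * t) y + (1 - gPhi (κ₂ * t) y)))
    (Λ : ℝ → ℝ) (hΛ : ∀ lam, Λ lam = ∫ y : ℝ, γ (Z lam y))
    (I : ℝ → ℝ) (hI : ∀ x, I x = ⨆ lam : ℝ, (lam * x - Λ lam)) :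
    (∀ lam : ℝ, Integrable (fun y : ℝ => γ (Z lam y)) volume) ∧
    Differentiable ℝ Λ ∧
    StrictConvexOn ℝ Set.univ Λ ∧
    Λ 0 = 0 ∧ deriv Λ 0 = 0 ∧
    I 0 = 0 ∧ (∀ x : ℝ, x ≠ 0 → 0 < I x) := by
  set s := κ₂ * t
  have hs : 0 < s := mul_pos hκ ht
  obtain rfl : γ = ProbabilityTheory.cgf η volume := funext hγ
  set γ := ProbabilityTheory.cgf η volume
  have hγC : ContDiff ℝ 1 γ := ProbabilityTheory.contDiff_cgf hint
  have hγ₀ : γ 0 = 0 := ProbabilityTheory.cgf_zero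
  have hγmono : StrictMono γ := ProbabilityTheory.strictMono_cgf hnonneg hpos hint
  have hγconv : ConvexOn ℝ Set.univ γ := ProbabilityTheory.convexOn_cgf hint
  set q : ℝ → ℝ := fun y => gPhi s (-y) with hq
  have hqi : IntegrableOn q (Set.Ioi 0) := integrableOn_gPhi_neg hs
  have hqI : ∀ y, 0 < y → q y ∈ Set.Ioc (0 : ℝ) (1 / 2) := fun y hy => gPhi_neg_mem_Ioc hs hy
  have hqae : ∀ᵐ y ∂volume.restrict (Set.Ioi (0 : ℝ)), q y ∈ Set.Ioc (0 : ℝ) (1 / 2) :=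
    (ae_restrict_iff' measurableSet_Ioi).2 (.of_forall hqI)
  have hqae' : ∀ᵐ y ∂volume.restrict (Set.Ioi (0 : ℝ)), q y ∈ Set.Icc (0 : ℝ) (1 / 2) :=
    hqae.mono fun _ h => Set.Ioc_subset_Icc_self h
  have hqanti : AntitoneOn q (Set.Ioi 0) := fun x _ y _ hxy => monotone_gPhi hs (neg_le_neg hxy)
  have : NeZero (volume.restrict (Set.Ioi (0 : ℝ))) := ⟨by simp⟩
  set h : ℝ → ℝ := fun lam => ∫ y in Set.Ioi 0, γ (bernoulliCgf (q y) lam) with hh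
  have hhi := integrable_comp_bernoulliCgf hγC hγ₀ hqi hqae'
  have hhd : Differentiable ℝ h := differentiable_integral_comp_bernoulliCgf hγC hγ₀ hqi hqae'
  have hhc : StrictConvexOn ℝ Set.univ h :=
    strictConvexOn_integral_comp_bernoulliCgf hγC hγ₀ hγmono hγconv hqi hqae
  have hh₀ : h 0 = 0 := by simp [hh, hγ₀]
  have hZpos : ∀ lam, ∀ y ∈ Set.Ioi (0 : ℝ), γ (Z lam y) = γ (bernoulliCgf (q y) lam) := by
    intro lam y hy
    rw [hZ, if_pos (Set.mem_Ioi.1 hy), bernoulliCgf, hq]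
    simp only [gPhi_neg hs]
    congr 2
    ring
  have hZneg : ∀ lam, ∀ y ∈ Set.Iic (0 : ℝ), γ (Z lam y) = γ (bernoulliCgf (q (-y)) (-lam)) := by
    intro lam y hy
    rw [hZ, if_neg (not_lt.2 (Set.mem_Iic.1 hy)), bernoulliCgf, hq]
    simp only [neg_neg]
    congr 2
    ring
  have hpos_int : ∀ lam, IntegrableOn (fun y => γ (Z lam y)) (Set.Ioi 0) := fun lam =>
    IntegrableOn.congr_fun (hhi lam) (fun y hy => (hZpos lam y hy).symm) measurableSet_Ioi
  have hneg_int : ∀ lam, IntegrableOn (fun y => γ (Z lam y)) (Set.Iic 0) := fun lam => by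
    refine IntegrableOn.congr_fun (f := fun y => γ (bernoulliCgf (q (-y)) (-lam))) ?_
      (fun y hy => (hZneg lam y hy).symm) measurableSet_Iic
    rw [integrableOn_Iic_iff_integrableOn_Iio]
    refine IntegrableOn.comp_neg_Iio (f := fun y => γ (bernoulliCgf (q y) (-lam))) ?_
    rw [neg_zero]
    exact hhi (-lam)
  have hZint : ∀ lam, Integrable (fun y => γ (Z lam y)) := fun lam => by
    rw [← integrableOn_univ, ← Set.Iic_union_Ioi (a := (0 : ℝ))]
    exact (hneg_int lam).union (hpos_int lam)
  have hΛh : ∀ lam, Λ lam = h lam + h (-lam) := fun lam => by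
    rw [hΛ, ← intervalIntegral.integral_Iic_add_Ioi (hneg_int lam) (hpos_int lam),
      setIntegral_congr_fun measurableSet_Ioi (hZpos lam),
      setIntegral_congr_fun measurableSet_Iic (hZneg lam),
      integral_comp_neg_Iic 0 (fun y => γ (bernoulliCgf (q y) (-lam))), neg_zero, add_comm]
  have heven : ∀ lam, Λ (-lam) = Λ lam := fun lam => by rw [hΛh, hΛh, neg_neg, add_comm]
  have hΛ₀ : Λ 0 = 0 := by simp [hΛh, hh₀]
  have hΛd : ∀ lam, HasDerivAt Λ (deriv h lam - deriv h (-lam)) lam := fun lam => by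
    have h1 : HasDerivAt (fun l => h (-l)) (deriv h (-lam) * -1) lam :=
      (hhd (-lam)).hasDerivAt.comp lam (hasDerivAt_neg lam)
    rw [funext hΛh]
    simpa [sub_eq_add_neg] using (hhd lam).hasDerivAt.fun_add h1
  have hΛd₀ : HasDerivAt Λ 0 0 := by simpa using hΛd 0
  have hΛc : StrictConvexOn ℝ Set.univ Λ := by
    rw [funext hΛh]
    refine hhc.add_convexOn ⟨convex_univ, fun x _ y _ a b ha hb hab => ?_⟩
    convert hhc.convexOn.2 (Set.mem_univ (-x)) (Set.mem_univ (-y)) ha hb hab using 2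
    simp only [smul_eq_mul]
    ring
  have hgrowth : ∀ A, ∃ C, ∀ l, 0 ≤ l → A * l - C ≤ Λ l := fun A => by
    obtain ⟨C, hC⟩ := exists_mul_sub_le_setIntegral_comp_bernoulliCgf hγC hγ₀ hγmono hγconv hqi
      hqI hqanti (A + deriv h 0)
    refine ⟨C, fun l hl => ?_⟩
    have h1 : -(deriv h 0 * l) ≤ h (-l) := by
      rcases hl.eq_or_lt with rfl | hl
      · simp [hh₀]
      · have := hhc.convexOn.slope_le_of_hasDerivAt (Set.mem_univ (-l)) (Set.mem_univ 0)
          (neg_neg_of_pos hl) (hhd 0).hasDerivAt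
        rw [slope_def_field, hh₀, div_le_iff₀ (by linarith)] at this
        linarith
    have h2 : (A + deriv h 0) * l - C ≤ h l := hC l hl
    rw [hΛh]
    linarith
  refine ⟨hZint, fun lam => (hΛd lam).differentiableAt, hΛc, hΛ₀, hΛd₀.deriv, ?_, fun x hx => ?_⟩
  · simpa [hI] using iSup_neg_eq_zero_of_convexOn_of_even hΛc.convexOn hΛ₀ heven
  · rw [hI]
    exact iSup_mul_sub_pos hΛd₀ hΛ₀ hx (bddAbove_range_mul_sub heven hgrowth x)
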